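/- Let a : ℝ^d → ℝ^d be twice differentiable and suppose a(z + b) = a(z) + b' for all z ∈ ℝ^d, for some fixed b, b' ∈ ℝ^d. Then the directional second derivative vanishes along b wherever the mean-value expansion holds on a set of positive measure and a is analytic; concretely, if a is analytic and for each component i,j the set S^{ij} = {θ : ∇_j a_i(z+b) = ∇_j a_i(z) + ∇²_j a_i(θ) b for some z} has positive Lebesgue measure, then (Hess a_j)(z) b = 0 for all z and all components j. -/

import Mathlib

open MeasureTheory

/-- An analytic function that does not vanish identically on a finite-dimensional real normed space
has a zero set of Haar measure zero. -/
theorem AnalyticOnNhd.measure_zeros_eq_zero {E : Type*} [NormedAddCommGroup E] [NormedSpace ℝ E]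
    [FiniteDimensional ℝ E] [MeasurableSpace E] [BorelSpace E] (μ : Measure E)
    [μ.IsAddHaarMeasure] {f : E → ℝ} (hf : AnalyticOnNhd ℝ f Set.univ) {x₀ : E}
    (hx₀ : f x₀ ≠ 0) : μ {x | f x = 0} = 0 := by
  have hline : ∀ v : E, volume {t : ℝ | f (x₀ + t • v) = 0} = 0 := by
    intro v
    have hg : AnalyticOnNhd ℝ (fun t : ℝ => f (x₀ + t • v)) Set.univ := fun t _ =>
      (hf _ trivial).fun_comp (analyticAt_const.add (analyticAt_id.smul analyticAt_const))
    rcases hg.eqOn_zero_or_eventually_ne_zero_of_preconnected isPreconnected_univ with h | h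
    · exact absurd (by simpa using h (Set.mem_univ (0 : ℝ))) hx₀
    · simpa [mem_ae_iff, Set.compl_def] using
        ae_restrict_le_codiscreteWithin (μ := volume) MeasurableSet.univ h
  have hcont : Continuous f := continuousOn_univ.mp hf.continuousOn
  have hmeas : MeasurableSet {p : ℝ × E | f (x₀ + p.1 • p.2) = 0} :=
    (isClosed_singleton.preimage (hcont.comp (by fun_prop :
      Continuous fun p : ℝ × E => x₀ + p.1 • p.2))).measurableSet
  have hprod : ((volume : Measure ℝ).prod μ) {p : ℝ × E | f (x₀ + p.1 • p.2) = 0} = 0 := by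
    rw [Measure.prod_apply_symm hmeas]
    simp only [Set.preimage_ofPred_eq, hline, lintegral_zero]
  have hae := Measure.measure_ae_null_of_prod_null hprod
  have hne : ∀ᵐ t : ℝ, t ≠ 0 := Measure.ae_ne volume 0
  obtain ⟨t, ht, ht0⟩ := (hae.and hne).exists
  have hpre : μ ((fun x => t • x) ⁻¹' ((fun x => x₀ + x) ⁻¹' {x | f x = 0})) = 0 := ht
  rw [Measure.addHaar_preimage_smul μ ht0, measure_preimage_add] at hpre
  simpa [ht0] using hpre

/-- If `a : ℝ^d → ℝ^d` is analytic, satisfies `a(z+b) = a(z) + b'` for all `z`,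
and for each pair of components `i, j` the set of mean-value points `θ`
satisfying `∇ⱼaᵢ(z+b) = ∇ⱼaᵢ(z) + ∇²ⱼaᵢ(θ)·b` for some `z` has positive
Lebesgue measure, then the Hessian of every component applied to `b` vanishes
everywhere: `(Hess aⱼ)(z)·b = 0` for all `z` and `j`. -/
theorem stmt_4 (d : ℕ) (a : (Fin d → ℝ) → (Fin d → ℝ)) (b b' : Fin d → ℝ)
    (hanal : AnalyticOnNhd ℝ a Set.univ)
    (hshift : ∀ z : Fin d → ℝ, a (z + b) = a z + b')
    (hmeas : ∀ i j : Fin d,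
      0 < volume {θ : Fin d → ℝ | ∃ z : Fin d → ℝ,
        fderiv ℝ (fun u => a u i) (z + b) (Pi.single j 1) =
          fderiv ℝ (fun u => a u i) z (Pi.single j 1) +
            fderiv ℝ (fun w => fderiv ℝ (fun u => a u i) w (Pi.single j 1)) θ b}) :
    ∀ (z : Fin d → ℝ) (j : Fin d),
      fderiv ℝ (fun w => fderiv ℝ (fun u => a u j) w b) z = 0 := by
  intro z j
  have hcomp : AnalyticOnNhd ℝ (fun u => a u j) Set.univ := fun u _ =>
    ((ContinuousLinearMap.proj (R := ℝ) (φ := fun _ : Fin d => ℝ) j).analyticAt (a u)).fun_comp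
      (hanal u trivial)
  have hfderiv_shift : ∀ u, fderiv ℝ (fun u => a u j) (u + b) = fderiv ℝ (fun u => a u j) u := by
    intro u
    rw [← fderiv_comp_add_right]
    simp [hshift]
  have hpartial : ∀ k w,
      fderiv ℝ (fun w => fderiv ℝ (fun u => a u j) w (Pi.single k 1)) w b = 0 := by
    intro k w
    by_contra hw
    have hsnd : AnalyticOnNhd ℝ
        (fun w => fderiv ℝ (fun w => fderiv ℝ (fun u => a u j) w (Pi.single k 1)) w b)
        Set.univ := by
      have hfst : AnalyticOnNhd ℝ
          (fun w => fderiv ℝ (fun u => a u j) w (Pi.single k 1)) Set.univ :=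
        fun w _ => ((ContinuousLinearMap.apply ℝ ℝ
          (Pi.single k 1 : Fin d → ℝ)).analyticAt _).fun_comp (hcomp.fderiv w trivial)
      exact fun w _ => ((ContinuousLinearMap.apply ℝ ℝ b).analyticAt _).fun_comp
        (hfst.fderiv w trivial)
    refine (hmeas j k).ne' ?_
    simpa [hfderiv_shift] using hsnd.measure_zeros_eq_zero volume hw
  have hdiff : DifferentiableAt ℝ (fderiv ℝ (fun u => a u j)) z :=
    (hcomp.fderiv z trivial).differentiableAt
  have happly : ∀ v w : Fin d → ℝ, fderiv ℝ (fun w => fderiv ℝ (fun u => a u j) w v) z w =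
      fderiv ℝ (fderiv ℝ (fun u => a u j)) z w v := by
    intro v w
    rw [fderiv_clm_apply hdiff (differentiableAt_const v)]
    simp
  have hsymm : IsSymmSndFDerivAt ℝ (fun u => a u j) z :=
    ((hcomp z trivial).contDiffAt).isSymmSndFDerivAt_of_omega
  refine ContinuousLinearMap.coe_injective ((Pi.basisFun ℝ (Fin d)).ext fun k => ?_)
  simpa [happly, hsymm.eq (Pi.single k 1) b] using hpartial k z
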